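/- Let n, m ≥ 1 and let φ : ℝⁿ → ℝᵐ be a smooth map with Δ(Δφ) = 0 everywhere, where Δ denotes the Euclidean Laplacian acting componentwise. If ∫_{ℝⁿ} ‖Δφ(x)‖^p dx < ∞ for some real p with 1 < p < ∞, then Δφ is a constant map: there exists a vector c ∈ ℝᵐ with Δφ(x) = c for all x ∈ ℝⁿ; in particular the derivative of Δφ vanishes identically and ‖Δφ‖ is constant. -/

import Mathlib

open MeasureTheory

/-- The Euclidean Laplacian of a map `f : ℝⁿ → F`, acting componentwise:
the sum of the second directional derivatives along the standard orthonormal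
basis of `ℝⁿ`. -/
noncomputable def eLap {n : ℕ} {F : Type*} [NormedAddCommGroup F] [NormedSpace ℝ F]
    (f : EuclideanSpace ℝ (Fin n) → F) (x : EuclideanSpace ℝ (Fin n)) : F :=
  ∑ i : Fin n,
    fderiv ℝ (fderiv ℝ f) x (EuclideanSpace.single i 1) (EuclideanSpace.single i 1)

/-- The Lipschitz radial profile `y ↦ (1 - ‖y‖²)₊` on `ℝⁿ`. -/
noncomputable def radialTent {n : ℕ} (y : EuclideanSpace ℝ (Fin n)) : ℝ :=
  max (1 - ‖y‖ ^ 2) 0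

section RadialTent

variable {n : ℕ}

lemma continuous_radialTent : Continuous (radialTent (n := n)) := by
  unfold radialTent
  fun_prop

lemma radialTent_nonneg (y : EuclideanSpace ℝ (Fin n)) : 0 ≤ radialTent y :=
  le_max_right _ _

lemma radialTent_le_one (y : EuclideanSpace ℝ (Fin n)) : radialTent y ≤ 1 :=
  max_le (by nlinarith [sq_nonneg ‖y‖]) zero_le_one

lemma radialTent_eq_zero {y : EuclideanSpace ℝ (Fin n)} (hy : y ∉ Metric.closedBall 0 1) :
    radialTent y = 0 := by
  rw [mem_closedBall_zero_iff, not_le] at hy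
  exact max_eq_right (by nlinarith)

lemma hasCompactSupport_radialTent : HasCompactSupport (radialTent (n := n)) :=
  HasCompactSupport.intro (isCompact_closedBall 0 1) fun _ => radialTent_eq_zero

lemma integral_radialTent_pos : 0 < ∫ y : EuclideanSpace ℝ (Fin n), radialTent y :=
  continuous_radialTent.integral_pos_of_hasCompactSupport_nonneg_nonzero
    hasCompactSupport_radialTent radialTent_nonneg (x := 0) (by simp [radialTent])

lemma hasDerivAt_max_zero_sq (s : ℝ) :
    HasDerivAt (fun s : ℝ => max s 0 ^ 2) (2 * max s 0) s := by
  rcases lt_trichotomy s 0 with hs | rfl | hs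
  · rw [max_eq_right hs.le, mul_zero]
    refine (hasDerivAt_const s (0 : ℝ)).congr_of_eventuallyEq ?_
    filter_upwards [Iio_mem_nhds hs] with t ht
    simp [max_eq_right (le_of_lt (Set.mem_Iio.1 ht))]
  · rw [max_self, mul_zero, hasDerivAt_iff_isLittleO_nhds_zero]
    have h : (fun h : ℝ => h ^ 2) =o[nhds 0] fun h : ℝ => h := by
      simpa using Asymptotics.isLittleO_pow_pow (𝕜 := ℝ) (m := 1) (n := 2) (by norm_num)
    refine (Asymptotics.IsBigO.of_norm_le fun h => ?_).trans_isLittleO h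
    rcases le_total h 0 with hh | hh <;> simp [hh, sq_nonneg]
  · rw [max_eq_left hs.le]
    refine (by simpa using hasDerivAt_pow 2 s : HasDerivAt (fun s : ℝ => s ^ 2) (2 * s) s)
      |>.congr_of_eventuallyEq ?_
    filter_upwards [Ioi_mem_nhds hs] with t ht
    simp [max_eq_left (le_of_lt (Set.mem_Ioi.1 ht))]

lemma hasFDerivAt_radialTent_sq (y : EuclideanSpace ℝ (Fin n)) :
    HasFDerivAt (fun y => radialTent y ^ 2) ((-4 * radialTent y) • innerSL ℝ y) y := by
  have h := (hasDerivAt_max_zero_sq (1 - ‖y‖ ^ 2)).comp_hasFDerivAt y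
    ((hasStrictFDerivAt_norm_sq y).hasFDerivAt.const_sub 1)
  refine h.congr_fderiv ?_
  ext v
  simp [radialTent]
  ring

end RadialTent

section Harmonic

variable {n : ℕ} {F : Type*} [NormedAddCommGroup F] [NormedSpace ℝ F]
  {u : EuclideanSpace ℝ (Fin n) → F}

/-- The radial tent function is, up to a constant, the weight of a radial vector field that is a
gradient; testing harmonicity against its potential kills the weighted radial derivative. -/
lemma integral_radialTent_smul_fderiv_eq_zero (hu : ContDiff ℝ 2 u) (hlap : ∀ x, eLap u x = 0)
    (x : EuclideanSpace ℝ (Fin n)) (t : ℝ) :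
    ∫ y, radialTent y • fderiv ℝ u (x + t • y) y = 0 := by
  have hu1 : ContDiff ℝ 1 (fderiv ℝ u) := hu.fderiv_right (by norm_num)
  have hc1 : Continuous (fderiv ℝ u) := hu1.continuous
  have hc2 : Continuous (fderiv ℝ (fderiv ℝ u)) := hu1.continuous_fderiv (by norm_num)
  have htent := continuous_radialTent (n := n)
  have hint {G : EuclideanSpace ℝ (Fin n) → F} (hG : Continuous G) :
      Integrable fun y => radialTent y • G y :=
    (htent.smul hG).integrable_of_hasCompactSupport hasCompactSupport_radialTent.smul_right
  have hint2 {G : EuclideanSpace ℝ (Fin n) → F} (hG : Continuous G) :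
      Integrable fun y => radialTent y ^ 2 • G y := by
    simpa only [sq, mul_smul] using hint (G := fun y => radialTent y • G y) (htent.smul hG)
  have hderiv (i : Fin n) (y : EuclideanSpace ℝ (Fin n)) :
      HasFDerivAt (fun y => fderiv ℝ u (x + t • y) (EuclideanSpace.single i 1))
        (((ContinuousLinearMap.apply ℝ F (EuclideanSpace.single i (1 : ℝ))).comp
          (fderiv ℝ (fderiv ℝ u) (x + t • y))).comp
            (t • ContinuousLinearMap.id ℝ (EuclideanSpace ℝ (Fin n)))) y := by
    have h1 : HasFDerivAt (fun y : EuclideanSpace ℝ (Fin n) => x + t • y)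
        (t • ContinuousLinearMap.id ℝ (EuclideanSpace ℝ (Fin n))) y :=
      ((hasFDerivAt_id y).const_smul t).const_add x
    have h2 := (hu1.differentiable (by norm_num) (x + t • y)).hasFDerivAt
    exact ((ContinuousLinearMap.apply ℝ F (EuclideanSpace.single i (1 : ℝ))).hasFDerivAt.comp
      (x + t • y) h2).comp y h1
  have hparts (i : Fin n) :
      ∫ y, (4 * y i) • radialTent y • fderiv ℝ u (x + t • y) (EuclideanSpace.single i 1) =
      ∫ y, radialTent y ^ 2 • t • fderiv ℝ (fderiv ℝ u) (x + t • y)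
        (EuclideanSpace.single i 1) (EuclideanSpace.single i 1) := by
    have key := integral_bilinear_hasFDerivAt_right_eq_neg_left_of_integrable
      (μ := (volume : Measure (EuclideanSpace ℝ (Fin n))))
      (B := ContinuousLinearMap.lsmul ℝ ℝ) (v := EuclideanSpace.single i (1 : ℝ))
      (f := fun y => radialTent y ^ 2)
      (g := fun y => fderiv ℝ u (x + t • y) (EuclideanSpace.single i 1))
      (f' := fun y => (-4 * radialTent y) • innerSL ℝ y) (g' := _)
      ?_ ?_ ?_ (fun y _ => hasFDerivAt_radialTent_sq y) (fun y _ => hderiv i y)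
    · simp only [ContinuousLinearMap.lsmul_apply] at key
      rw [← integral_neg] at key
      convert! key.symm using 2
      · ext y
        rw [← neg_smul, smul_smul]
        congr 1
        simp [EuclideanSpace.inner_single_right]
        ring
      · ext y
        simp
    · refine (hint (G := fun y => (-4 * y i) •
        fderiv ℝ u (x + t • y) (EuclideanSpace.single i 1)) (by fun_prop)).congr
          (.of_forall fun y => ?_)
      simp [EuclideanSpace.inner_single_right, smul_smul]
      ring_nf
    · refine (hint2 (G := fun y => t • fderiv ℝ (fderiv ℝ u) (x + t • y)
        (EuclideanSpace.single i 1) (EuclideanSpace.single i 1)) (by fun_prop)).congr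
          (.of_forall fun y => ?_)
      simp [smul_comm t]
    · exact hint2 (by fun_prop)
  have hsum : ∫ y, (4 : ℝ) • radialTent y • fderiv ℝ u (x + t • y) y = 0 := calc
    _ = ∫ y, ∑ i, (4 * y i) • radialTent y •
          fderiv ℝ u (x + t • y) (EuclideanSpace.single i 1) := by
      refine integral_congr_ae (.of_forall fun y => ?_)
      have hy : y = ∑ i, y i • EuclideanSpace.single i (1 : ℝ) := by
        ext j
        simp [Finset.sum_apply, Pi.single_apply]
      beta_reduce
      conv_lhs => enter [2, 2]; rw [hy, map_sum]
      rw [← hy, Finset.smul_sum, Finset.smul_sum]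
      refine Finset.sum_congr rfl fun i _ => ?_
      rw [map_smul, smul_smul, smul_smul, smul_smul]
      ring_nf
    _ = ∑ i, ∫ y, radialTent y ^ 2 • t • fderiv ℝ (fderiv ℝ u) (x + t • y)
          (EuclideanSpace.single i 1) (EuclideanSpace.single i 1) := by
      rw [integral_finsetSum]
      · exact Finset.sum_congr rfl fun i _ => hparts i
      · intro i _
        refine (hint (G := fun y => (4 * y i) •
          fderiv ℝ u (x + t • y) (EuclideanSpace.single i 1)) (by fun_prop)).congr
            (.of_forall fun y => smul_comm _ _ _)
    _ = ∫ y, radialTent y ^ 2 • t • eLap u (x + t • y) := by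
      rw [← integral_finsetSum]
      · simp only [eLap, Finset.smul_sum]
      · exact fun i _ => hint2 (by fun_prop)
    _ = 0 := by simp [hlap]
  rw [integral_smul] at hsum
  exact (smul_eq_zero.1 hsum).resolve_left (by norm_num)

/-- A mean value property for harmonic functions, for averages weighted by the radial tent. -/
lemma integral_radialTent_smul_eq [CompleteSpace F] (hu : ContDiff ℝ 2 u)
    (hlap : ∀ x, eLap u x = 0) (x : EuclideanSpace ℝ (Fin n)) (R : ℝ) :
    ∫ y, radialTent y • u (x + R • y) =
      (∫ y : EuclideanSpace ℝ (Fin n), radialTent y) • u x := by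
  have hc0 : Continuous u := hu.continuous
  have hc1 : Continuous (fderiv ℝ u) := hu.continuous_fderiv (by norm_num)
  have htent := continuous_radialTent (n := n)
  have hd (t : ℝ) :
      HasDerivAt (fun t : ℝ => ∫ y, radialTent y • u (x + t • y)) 0 t := by
    obtain ⟨C, hC⟩ := ((isCompact_closedBall t 1).prod
      (isCompact_closedBall (0 : EuclideanSpace ℝ (Fin n)) 1)).exists_bound_of_continuousOn
      (f := fun q : ℝ × EuclideanSpace ℝ (Fin n) => fderiv ℝ u (x + q.1 • q.2) q.2)
      (by fun_prop)
    rw [← integral_radialTent_smul_fderiv_eq_zero hu hlap x t]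
    refine (hasDerivAt_integral_of_dominated_loc_of_deriv_le
      (bound := fun y => radialTent y * C)
      (F' := fun t y => radialTent y • fderiv ℝ u (x + t • y) y)
      (Metric.ball_mem_nhds t one_pos) ?_ ?_ ?_ ?_ ?_ ?_).2
    · exact .of_forall fun s => Continuous.aestronglyMeasurable (by fun_prop)
    · exact Continuous.integrable_of_hasCompactSupport (by fun_prop)
        hasCompactSupport_radialTent.smul_right
    · exact Continuous.aestronglyMeasurable (by fun_prop)
    · refine .of_forall fun y s hs => ?_
      by_cases hy : y ∈ Metric.closedBall 0 1
      · rw [norm_smul, Real.norm_of_nonneg (radialTent_nonneg y)]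
        exact mul_le_mul_of_nonneg_left (hC (s, y) ⟨Metric.ball_subset_closedBall hs, hy⟩)
          (radialTent_nonneg y)
      · simp [radialTent_eq_zero hy]
    · exact Continuous.integrable_of_hasCompactSupport (by fun_prop)
        hasCompactSupport_radialTent.mul_right
    · refine .of_forall fun y s _ => ?_
      have h1 : HasDerivAt (fun s : ℝ => x + s • y) y s := by
        simpa using ((hasDerivAt_id s).smul_const y).const_add x
      exact ((hu.differentiable (by norm_num) (x + s • y)).hasFDerivAt.comp_hasDerivAt s
        h1).const_smul (radialTent y)
  have h := is_const_of_deriv_eq_zero (fun t => (hd t).differentiableAt)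
    (fun t => (hd t).deriv) R 0
  simpa [integral_smul_const] using h

lemma le_add_rpow_mul_rpow {a ε p : ℝ} (ha : 0 ≤ a) (hε : 0 < ε) (hp : 1 ≤ p) :
    a ≤ ε + ε ^ (1 - p) * a ^ p := by
  rcases le_or_gt a ε with h | h
  · have : 0 ≤ ε ^ (1 - p) * a ^ p := by positivity
    linarith
  · have ha' : 0 < a := hε.trans h
    calc a = a ^ (1 - p) * a ^ p := by rw [← Real.rpow_add ha']; simp
      _ ≤ ε ^ (1 - p) * a ^ p := by
        gcongr ?_ * _
        exact Real.rpow_le_rpow_of_nonpos hε h.le (by linarith)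
      _ ≤ _ := by linarith

/-- Liouville theorem: an `Lᵖ` harmonic map on `ℝⁿ` with `n ≥ 1` and `1 ≤ p < ∞`, vanishes. -/
theorem eq_zero_of_eLap_eq_zero_of_integrable_rpow [CompleteSpace F] (hn : n ≠ 0)
    (hu : ContDiff ℝ 2 u) (hlap : ∀ x, eLap u x = 0) {p : ℝ} (hp : 1 ≤ p)
    (hLp : Integrable fun x => ‖u x‖ ^ p) (x : EuclideanSpace ℝ (Fin n)) : u x = 0 := by
  have hc0 : Continuous u := hu.continuous
  have htent := continuous_radialTent (n := n)
  set J := ∫ y : EuclideanSpace ℝ (Fin n), radialTent y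
  set A := ∫ y, ‖u y‖ ^ p with hA
  have hJpos : 0 < J := integral_radialTent_pos
  have hbound (ε : ℝ) (hε : 0 < ε) (R : ℝ) (hR : 0 < R) :
      J * ‖u x‖ ≤ ε * J + ε ^ (1 - p) * ((R ^ n)⁻¹ * A) := by
    have hLpR : Integrable fun y => ‖u (x + R • y)‖ ^ p :=
      (hLp.comp_add_left x).comp_smul (f := fun y => ‖u (x + y)‖ ^ p) hR.ne'
    have hscale : ∫ y, ‖u (x + R • y)‖ ^ p = (R ^ n)⁻¹ * A := by
      rw [Measure.integral_comp_smul_of_nonneg volume (fun y => ‖u (x + y)‖ ^ p) R (hR := hR.le),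
        integral_add_left_eq_self (fun y => ‖u y‖ ^ p) x]
      simp [hA]
    have htentInt : Integrable (radialTent (n := n)) :=
      htent.integrable_of_hasCompactSupport hasCompactSupport_radialTent
    calc J * ‖u x‖ = ‖∫ y, radialTent y • u (x + R • y)‖ := by
          rw [integral_radialTent_smul_eq hu hlap, norm_smul, Real.norm_of_nonneg hJpos.le]
      _ ≤ ∫ y, (ε * radialTent y + ε ^ (1 - p) * ‖u (x + R • y)‖ ^ p) := by
          refine norm_integral_le_of_norm_le
            ((htentInt.const_mul _).add (hLpR.const_mul _)) (.of_forall fun y => ?_)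
          rw [norm_smul, Real.norm_of_nonneg (radialTent_nonneg y)]
          have h1 := le_add_rpow_mul_rpow (norm_nonneg (u (x + R • y))) hε hp
          have h2 : 0 ≤ ε ^ (1 - p) * ‖u (x + R • y)‖ ^ p := by positivity
          nlinarith [radialTent_nonneg y, radialTent_le_one y]
      _ = _ := by
          rw [integral_add (htentInt.const_mul _) (hLpR.const_mul _), integral_const_mul,
            integral_const_mul, hscale]
  have hle (ε : ℝ) (hε : 0 < ε) : ‖u x‖ ≤ ε := by
    have hlim : Filter.Tendsto (fun R : ℝ => ε * J + ε ^ (1 - p) * ((R ^ n)⁻¹ * A))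
        Filter.atTop (nhds (ε * J)) := by
      simpa using (((Filter.tendsto_pow_atTop hn).inv_tendsto_atTop.mul_const A).const_mul
        (ε ^ (1 - p))).const_add (ε * J)
    have h := ge_of_tendsto hlim ((Filter.eventually_gt_atTop 0).mono (hbound ε hε))
    rw [mul_comm ε] at h
    exact le_of_mul_le_mul_left h hJpos
  exact norm_le_zero_iff.1 (le_of_forall_pos_le_add fun ε hε => by simpa using hle ε hε)

lemma ContDiff.eLap_top (hu : ContDiff ℝ (⊤ : ℕ∞) u) : ContDiff ℝ (⊤ : ℕ∞) (eLap u) := by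
  have h1 : ContDiff ℝ (⊤ : ℕ∞) (fderiv ℝ u) := hu.fderiv_right (by simp)
  have h2 : ContDiff ℝ (⊤ : ℕ∞) (fderiv ℝ (fderiv ℝ u)) := h1.fderiv_right (by simp)
  unfold eLap
  fun_prop

end Harmonic

/-- If `φ : ℝⁿ → ℝᵐ` is smooth with `Δ(Δφ) = 0` and
`∫ ‖Δφ‖ᵖ < ∞` for some `1 < p < ∞`, then `Δφ` is a constant map; in particular
its derivative vanishes identically and `‖Δφ‖` is constant. -/
theorem biharmonic_Lp_tension_parallel
    (n m : ℕ) (hn : 1 ≤ n) (hm : 1 ≤ m)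
    (φ : EuclideanSpace ℝ (Fin n) → EuclideanSpace ℝ (Fin m))
    (hφ : ContDiff ℝ (⊤ : ℕ∞) φ)
    (hbih : ∀ x, eLap (eLap φ) x = 0)
    (p : ℝ) (hp : 1 < p)
    (hLp : Integrable (fun x => ‖eLap φ x‖ ^ p) (volume : Measure (EuclideanSpace ℝ (Fin n)))) :
    ∃ c : EuclideanSpace ℝ (Fin m),
      (∀ x, eLap φ x = c) ∧
      (∀ x, fderiv ℝ (eLap φ) x = 0) ∧
      (∀ x y, ‖eLap φ x‖ = ‖eLap φ y‖) := by
  have hzero : ∀ x, eLap φ x = 0 :=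
    eq_zero_of_eLap_eq_zero_of_integrable_rpow (by omega)
      (hφ.eLap_top.of_le (WithTop.coe_le_coe.2 (le_top : (2 : ℕ∞) ≤ ⊤))) hbih hp.le hLp
  refine ⟨0, hzero, fun x => ?_, fun x y => by rw [hzero, hzero]⟩
  simp [show eLap φ = fun _ => 0 from funext hzero]
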